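/- arXiv:2602.23837 — 2 statements merged into one kernel-verified Lean document; each statement's English description precedes it below -/
import Mathlib

section
/- Fix n ≥ m ≥ 2, an integer k with 1 ≤ k ≤ n, a pair (M,N) ∈ 𝒞_{n,k}, and a tuple (x_1,…,x_{m−2}) ∈ 𝒯_M. Then the number of configurations β ∈ Ω = (ℤ/nℤ) → {0,1} satisfying N1(β) = k, N_{10^s1}(β) = x_s for each s ∈ {1,…,m−2}, and N_{0^{m−1}1}(β) = N, equals (n/k) · k!/(x_1!⋯x_{m−2}!·N!·(k−N−x_1−⋯−x_{m−2})!) · C(n−k−M−(m−2)N−1, N−1). -/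
open Finset

/-- Per-site transition factor `q_i(α, b)` of the m-NED: if the window
`(α_i, …, α_{i+m-1})` is `0^m` the site becomes `1` with probability `p1`;
if it is `0^{m-1}1` it becomes `1` with probability `1 - p2`; otherwise it
becomes `0` with probability `1`. -/
noncomputable def nedQ (n m : ℕ) (p1 p2 : ℝ) (α : ZMod n → Bool) (i : ZMod n) (b : Bool) : ℝ :=
  if ∀ j : Fin m, α (i + (j.val : ZMod n)) = false then
    if b then p1 else 1 - p1
  else if (∀ j : Fin (m - 1), α (i + (j.val : ZMod n)) = false) ∧
      α (i + ((m - 1 : ℕ) : ZMod n)) = true then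
    if b then 1 - p2 else p2
  else if b then 0 else 1

/-- Transition probability `P(α → β)` of the m-NED on the ring of `n` sites. -/
noncomputable def nedP (n m : ℕ) [NeZero n] (p1 p2 : ℝ) (α β : ZMod n → Bool) : ℝ :=
  ∏ i : ZMod n, nedQ n m p1 p2 α i (β i)

/-- `N₁(β)`: the number of sites carrying the symbol `1`. -/
def nedN1 (n : ℕ) [NeZero n] (β : ZMod n → Bool) : ℕ :=
  (univ.filter fun i : ZMod n => β i = true).card

/-- `N_{10^r 1}(β)`: the number of occurrences of the subsequence `1 0^r 1`. -/
def nedN10r1 (n : ℕ) [NeZero n] (r : ℕ) (β : ZMod n → Bool) : ℕ :=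
  (univ.filter fun i : ZMod n =>
    β i = true ∧ (∀ j : Fin r, β (i + ((j.val + 1 : ℕ) : ZMod n)) = false) ∧
      β (i + ((r + 1 : ℕ) : ZMod n)) = true).card

/-- `N_{0^r 1}(β)`: the number of occurrences of the subsequence `0^r 1`. -/
def nedN0r1 (n : ℕ) [NeZero n] (r : ℕ) (β : ZMod n → Bool) : ℕ :=
  (univ.filter fun i : ZMod n =>
    (∀ j : Fin r, β (i + (j.val : ZMod n)) = false) ∧
      β (i + ((r : ℕ) : ZMod n)) = true).card

/-- The stationary weight
`W(β) = p1^{N₁(β)} (1-p1)^{∑_{r=1}^{m-2} r N_{10^r1}(β) + (m-1) N_{0^{m-1}1}(β)} p2^{-N_{0^{m-1}1}(β)}`. -/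
noncomputable def nedW (n m : ℕ) [NeZero n] (p1 p2 : ℝ) (β : ZMod n → Bool) : ℝ :=
  p1 ^ nedN1 n β *
    (1 - p1) ^ ((∑ r ∈ Finset.Icc 1 (m - 2), r * nedN10r1 n r β) +
      (m - 1) * nedN0r1 n (m - 1) β) / p2 ^ nedN0r1 n (m - 1) β

/-- The partition function `Z_{n,m} = ∑_{β ∈ Ω} W(β)`. -/
noncomputable def nedZ (n m : ℕ) [NeZero n] (p1 p2 : ℝ) : ℝ :=
  ∑ β : ZMod n → Bool, nedW n m p1 p2 β

/-- Integer binomial coefficient with the convention `C(-1,-1) = 1`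
(and value `0` when the lower index is otherwise negative). -/
def ichoose (a b : ℤ) : ℕ :=
  if a = -1 ∧ b = -1 then 1 else if 0 ≤ b then Nat.choose a.toNat b.toNat else 0

/-- The multinomial coefficient `k! / (x₁! ⋯ x_t! · N! · (k - N - ∑ x)!)`, written as the
product of successive binomial coefficients (hence `0` whenever `N + ∑ x > k`). -/
def multChain {t : ℕ} (k : ℕ) (x : Fin t → ℕ) (N : ℕ) : ℕ :=
  (∏ j : Fin t, Nat.choose (k - ∑ s ∈ univ.filter (fun s => s < j), x s) (x j)) *
    Nat.choose (k - ∑ s, x s) N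

/-- `𝒯_M`: the tuples `(x_1, …, x_{m-2}) ∈ {0,1,…,k}^{m-2}` with `∑_{s=1}^{m-2} s·x_s = M`. -/
def nedT (m k M : ℕ) : Finset (Fin (m - 2) → ℕ) :=
  (Fintype.piFinset fun _ : Fin (m - 2) => Finset.range (k + 1)).filter fun x =>
    ∑ s, (s.val + 1) * x s = M

/-- `𝒞_{n,k}`: the pairs `(M, N)` of nonnegative integers with
`M ∈ {0,…,n-k-m+1} ∪ {n-k}`, `(m-1)·N + M ≤ n-k`, and `N = 0 ↔ M = n-k`. -/
def nedC (n m k : ℕ) : Finset (ℕ × ℕ) :=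
  (Finset.range (n + 1) ×ˢ Finset.range (n + 1)).filter fun MN =>
    (MN.1 + (m - 1) ≤ n - k ∨ MN.1 = n - k) ∧
      MN.2 * (m - 1) + MN.1 ≤ n - k ∧ (MN.2 = 0 ↔ MN.1 = n - k)

/-- `|Pos_{a₁b₁,a₂b₂}|`: the number of sites `i` with `(α_i, α_{i+1}) = (a₁, b₁)` and
`(β_i, β_{i+1}) = (a₂, b₂)`. -/
def posCount (n : ℕ) [NeZero n] (α β : ZMod n → Bool) (a1 b1 a2 b2 : Bool) : ℕ :=
  (univ.filter fun i : ZMod n =>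
    α i = a1 ∧ α (i + 1) = b1 ∧ β i = a2 ∧ β (i + 1) = b2).card

/-- The explicit sequence `Z_0 = 2`,
`Z_n = 1 + ∑_{k=1}^n ∑_{j=0}^{n-k} (n/k)·C(k,j)·C(n-k-1,j-1)·p1^k·q2^j` for `n ≥ 1`,
with `q2 = (1-p1)/p2` and the convention `C(-1,-1) = 1`. -/
noncomputable def Zseq (p1 p2 : ℝ) (n : ℕ) : ℝ :=
  if n = 0 then 2
  else 1 + ∑ k ∈ Finset.Icc 1 n, ∑ j ∈ Finset.range (n - k + 1),
    (n : ℝ) / k * (Nat.choose k j : ℝ) * (ichoose ((n : ℤ) - k - 1) ((j : ℤ) - 1) : ℝ) *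
      p1 ^ k * ((1 - p1) / p2) ^ j

/-- The unnormalized density sequence `D_0 = 0`,
`D_n = ∑_{k=1}^n ∑_{j=0}^{n-k} C(k,j)·C(n-k-1,j-1)·p1^k·q2^j` for `n ≥ 1`. -/
noncomputable def Dseq (p1 p2 : ℝ) (n : ℕ) : ℝ :=
  if n = 0 then 0
  else ∑ k ∈ Finset.Icc 1 n, ∑ j ∈ Finset.range (n - k + 1),
    (Nat.choose k j : ℝ) * (ichoose ((n : ℤ) - k - 1) ((j : ℤ) - 1) : ℝ) *
      p1 ^ k * ((1 - p1) / p2) ^ j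

/-- The partition function of the 2-NED on a ring of `n ≥ 1` sites,
`Z_{n,2} = ∑_{β ∈ Ω} p1^{N₁(β)} ((1-p1)/p2)^{N_{01}(β)}` (with value `2` at `n = 0`). -/
noncomputable def Zpart2 (p1 p2 : ℝ) (n : ℕ) : ℝ :=
  if h : n = 0 then 2
  else
    haveI : NeZero n := ⟨h⟩
    ∑ β : ZMod n → Bool, p1 ^ nedN1 n β * ((1 - p1) / p2) ^ nedN0r1 n 1 β

theorem card_piAntidiag_nat {ι : Type*} [DecidableEq ι] (s : Finset ι) (R : ℕ) :
    #(piAntidiag s R) = (#s + R - 1).choose R := by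
  rw [← card_finsuppAntidiag_nat_eq_choose]
  symm
  refine card_bij (fun f _ => ⇑f) ?_ (fun f _ g _ h => DFunLike.coe_injective h) ?_
  · intro f hf
    rw [mem_finsuppAntidiag] at hf
    rw [mem_piAntidiag]
    exact ⟨hf.1, fun i hi => hf.2 (Finsupp.mem_support_iff.2 hi)⟩
  · intro g hg
    rw [mem_piAntidiag] at hg
    refine ⟨Finsupp.onFinset s g hg.2, ?_, rfl⟩
    rw [mem_finsuppAntidiag]
    exact ⟨hg.1, Finsupp.support_onFinset_subset⟩

/-- The families of pairwise disjoint subsets of `S` with prescribed cardinalities `y`. -/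
def disjointFamilies {ι : Type*} [DecidableEq ι] {t : ℕ} (S : Finset ι) (y : Fin t → ℕ) :
    Finset (Fin t → Finset ι) :=
  (Fintype.piFinset fun s => S.powersetCard (y s)).filter
    fun A => ∀ i j, i ≠ j → Disjoint (A i) (A j)

theorem mem_disjointFamilies {ι : Type*} [DecidableEq ι] {t : ℕ} {S : Finset ι}
    {y : Fin t → ℕ} {A : Fin t → Finset ι} :
    A ∈ disjointFamilies S y ↔
      (∀ s, A s ⊆ S ∧ #(A s) = y s) ∧ ∀ i j, i ≠ j → Disjoint (A i) (A j) := by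
  simp [disjointFamilies, mem_powersetCard]

theorem card_disjointFamilies {ι : Type*} [DecidableEq ι] {t : ℕ} (S : Finset ι)
    (y : Fin t → ℕ) :
    #(disjointFamilies S y) =
      ∏ j : Fin t, (#S - ∑ s ∈ univ.filter (fun s => s < j), y s).choose (y j) := by
  induction t generalizing S with
  | zero => simp [disjointFamilies]
  | succ t ih =>
    have hbij : #(disjointFamilies S y) =
        #((S.powersetCard (y 0)).sigma fun B => disjointFamilies (S \ B) (Fin.tail y)) := by
      refine card_nbij' (fun A => ⟨A 0, Fin.tail A⟩) (fun B => Fin.cons B.1 B.2) ?_ ?_ ?_ ?_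
      · intro A hA
        simp only [mem_coe, mem_disjointFamilies, mem_sigma, mem_powersetCard] at hA ⊢
        refine ⟨hA.1 0, fun s => ⟨?_, (hA.1 s.succ).2⟩,
          fun i j hij => hA.2 _ _ (by simpa using hij)⟩
        exact subset_sdiff.2 ⟨(hA.1 s.succ).1, hA.2 _ _ (Fin.succ_ne_zero s)⟩
      · rintro ⟨B, A⟩ hA
        simp only [mem_coe, mem_disjointFamilies, mem_sigma, mem_powersetCard] at hA ⊢
        obtain ⟨hB, hA, hd⟩ := hA
        have hBA : ∀ i, Disjoint (A i) B := fun i => (subset_sdiff.1 (hA i).1).2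
        refine ⟨fun s => ?_, ?_⟩
        · induction s using Fin.cases with
          | zero => exact hB
          | succ s => exact ⟨(subset_sdiff.1 (hA s).1).1, (hA s).2⟩
        · intro i j hij
          induction i using Fin.cases with
          | zero =>
            induction j using Fin.cases with
            | zero => exact absurd rfl hij
            | succ j => simpa using (hBA j).symm
          | succ i =>
            induction j using Fin.cases with
            | zero => simpa using hBA i
            | succ j => simpa using hd i j (by simpa using hij)
      · intro A _
        simp
      · rintro ⟨B, A⟩ _
        simp
    rw [hbij, card_sigma, Fin.prod_univ_succ]
    have hcard : ∀ B ∈ S.powersetCard (y 0), #(disjointFamilies (S \ B) (Fin.tail y)) =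
        ∏ j : Fin t, (#S - ∑ s ∈ univ.filter (fun s => s < j.succ), y s).choose (y j.succ) := by
      intro B hB
      rw [mem_powersetCard] at hB
      rw [ih, card_sdiff_of_subset hB.1, hB.2]
      refine prod_congr rfl fun j _ => ?_
      simp [sum_filter, Fin.sum_univ_succ, Fin.tail, Nat.sub_sub]
    rw [sum_congr rfl hcard, sum_const, card_powersetCard]
    simp

theorem multChain_eq_card {ι : Type*} [DecidableEq ι] {t : ℕ} (S : Finset ι) (x : Fin t → ℕ)
    (N : ℕ) : multChain #S x N = #(disjointFamilies S (Fin.snoc x N : Fin (t + 1) → ℕ)) := by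
  rw [card_disjointFamilies, Fin.prod_univ_castSucc]
  simp [multChain, sum_filter, Fin.sum_univ_castSucc, Fin.castSucc_lt_last,
    (Fin.castSucc_lt_last _).not_gt]

theorem sum_ite_eq_succ (t v : ℕ) (hv : v ≤ t) :
    ∑ s : Fin t, (if v = s.val + 1 then s.val + 1 else 0) = v := by
  rcases v with _ | v
  · simp
  · rw [sum_eq_single (⟨v, hv⟩ : Fin t)]
    · simp
    · intro b _ hb
      rw [if_neg]
      intro h
      exact hb (Fin.ext (by simp; omega))
    · simp

theorem level_add_tail {ι : Type*} [DecidableEq ι] {t : ℕ} {A : Fin (t + 1) → Finset ι}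
    (hd : ∀ i j, i ≠ j → Disjoint (A i) (A j)) {h : ι → ℕ}
    (hh : ∀ j, h j ≠ 0 → j ∈ A (Fin.last t)) (j : ι) :
    (∀ s : Fin (t + 1),
      min (∑ s : Fin (t + 1), (if j ∈ A s then s.val + 1 else 0) + h j) (t + 1) = s.val + 1 ↔
        j ∈ A s) ∧
      ∑ s : Fin (t + 1), (if j ∈ A s then s.val + 1 else 0) + h j - (t + 1) = h j := by
  have hv : ∀ s, j ∈ A s → ∑ s : Fin (t + 1), (if j ∈ A s then s.val + 1 else 0) = s.val + 1 := by
    intro s hs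
    rw [sum_eq_single s, if_pos hs]
    · intro b _ hb
      rw [if_neg fun hb' => disjoint_left.1 (hd b s hb) hb' hs]
    · simp
  by_cases hj : ∃ s, j ∈ A s
  · obtain ⟨s, hs⟩ := hj
    have hs' := s.2
    have hh' : h j ≠ 0 → s.val = t := fun h0 => by
      have := hv s hs
      rw [hv _ (hh j h0)] at this
      simpa using this.symm
    rw [hv s hs]
    refine ⟨fun s' => ⟨fun he => ?_, fun hs' => ?_⟩, by omega⟩
    · have : s = s' := Fin.ext (by omega)
      rwa [← this]
    · have := hv s hs
      rw [hv s' hs'] at this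
      omega
  · push Not at hj
    have h0 : h j = 0 := by
      by_contra h0
      exact hj _ (hh j h0)
    simp [hj, h0]

theorem card_piAntidiag_levels {ι : Type*} [DecidableEq ι] {t : ℕ} (S : Finset ι) (x : Fin t → ℕ)
    (N R : ℕ) :
    #((piAntidiag S (∑ s, (s.val + 1) * x s + (t + 1) * N + R)).filter fun g =>
      (∀ s : Fin t, #{j ∈ S | g j = s.val + 1} = x s) ∧ #{j ∈ S | t + 1 ≤ g j} = N) =
    multChain #S x N * (N + R - 1).choose R := by
  set y : Fin (t + 1) → ℕ := Fin.snoc x N with hy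
  have hyl : y (Fin.last t) = N := by simp [hy]
  have hyc : ∀ s : Fin t, y s.castSucc = x s := by simp [hy]
  have hsumy : ∑ s : Fin (t + 1), (s.val + 1) * y s = ∑ s, (s.val + 1) * x s + (t + 1) * N := by
    rw [Fin.sum_univ_castSucc]; simp [hyl, hyc]
  have hcard : ∀ A ∈ disjointFamilies S y,
      #(piAntidiag (A (Fin.last t)) R) = (N + R - 1).choose R := by
    intro A hA
    rw [card_piAntidiag_nat, ((mem_disjointFamilies.1 hA).1 _).2, hyl]
  have hsig : #((disjointFamilies S y).sigma fun A => piAntidiag (A (Fin.last t)) R) =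
      multChain #S x N * (N + R - 1).choose R := by
    rw [card_sigma, sum_congr rfl hcard, sum_const, multChain_eq_card, smul_eq_mul]
  rw [← hsig]
  have hlev : ∀ g : ι → ℕ, ((∀ s : Fin t, #{j ∈ S | g j = s.val + 1} = x s) ∧
      #{j ∈ S | t + 1 ≤ g j} = N) ↔
      ∀ s : Fin (t + 1), #{j ∈ S | min (g j) (t + 1) = s.val + 1} = y s := by
    intro g
    rw [Fin.forall_fin_succ']
    refine and_congr (forall_congr' fun s => ?_) ?_
    · rw [hyc]
      have : ∀ j, g j = s.val + 1 ↔ min (g j) (t + 1) = s.castSucc.val + 1 := by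
        intro j; have := s.2; simp; omega
      simp_rw [this]
    · rw [hyl]
      have : ∀ j, t + 1 ≤ g j ↔ min (g j) (t + 1) = (Fin.last t).val + 1 := by
        intro j; simp
      simp_rw [this]
  simp_rw [hlev, ← hsumy]
  refine card_nbij' (fun g => ⟨fun s => {j ∈ S | min (g j) (t + 1) = s.val + 1},
      fun j => g j - (t + 1)⟩)
    (fun Ah j => ∑ s : Fin (t + 1), (if j ∈ Ah.1 s then s.val + 1 else 0) + Ah.2 j) ?_ ?_ ?_ ?_
  · intro g hg
    simp only [mem_coe, mem_filter, mem_piAntidiag, mem_sigma, mem_disjointFamilies] at hg ⊢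
    obtain ⟨⟨hsum, hsupp⟩, hfib⟩ := hg
    refine ⟨⟨fun s => ⟨filter_subset _ _, hfib s⟩, fun i j hij => ?_⟩, ?_, ?_⟩
    · rw [disjoint_left]
      intro a ha hb
      simp only [mem_filter] at ha hb
      exact hij (Fin.ext (by omega))
    · have h1 : ∑ j ∈ S, min (g j) (t + 1) = ∑ s : Fin (t + 1), (s.val + 1) * y s := by
        calc ∑ j ∈ S, min (g j) (t + 1)
            = ∑ j ∈ S, ∑ s : Fin (t + 1),
                (if min (g j) (t + 1) = s.val + 1 then s.val + 1 else 0) :=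
              sum_congr rfl fun j _ => (sum_ite_eq_succ _ _ (min_le_right _ _)).symm
          _ = _ := by
              rw [sum_comm]
              refine sum_congr rfl fun s _ => ?_
              rw [← sum_filter, sum_const, hfib, smul_eq_mul, mul_comm]
      have h2 : ∑ j ∈ S, g j = ∑ j ∈ S, min (g j) (t + 1) + ∑ j ∈ S, (g j - (t + 1)) := by
        rw [← sum_add_distrib]
        exact sum_congr rfl fun j _ => by omega
      have h3 : ∑ j ∈ S with min (g j) (t + 1) = (Fin.last t).val + 1, (g j - (t + 1)) =
          ∑ j ∈ S, (g j - (t + 1)) := by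
        refine sum_filter_of_ne fun j _ h => ?_
        simp; omega
      rw [h3]
      change ∑ j ∈ S, g j = _ at hsum
      omega
    · intro j hj
      exact ⟨hsupp j (by omega), by simp; omega⟩
  · rintro ⟨A, h⟩ hA
    simp only [mem_coe, mem_filter, mem_piAntidiag, mem_sigma, mem_disjointFamilies] at hA ⊢
    obtain ⟨⟨hA, hd⟩, hsum, hsupp⟩ := hA
    refine ⟨⟨?_, fun j hj => ?_⟩, fun s => ?_⟩
    · have h1 : ∑ j ∈ S, h j = R := by
        rw [← hsum]
        exact (sum_subset (hA _).1 fun j _ hj => by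
          by_contra h0
          exact hj (hsupp j h0)).symm
      rw [sum_add_distrib, h1, sum_comm]
      congr 1
      refine sum_congr rfl fun s _ => ?_
      rw [← sum_filter, sum_const, filter_mem_eq_inter, inter_eq_right.2 (hA s).1, (hA s).2,
        smul_eq_mul, mul_comm]
    · by_contra hjS
      have hjA : ∀ s, j ∉ A s := fun s hs => hjS ((hA s).1 hs)
      have h0 : h j = 0 := by
        by_contra h0
        exact hjA _ (hsupp j h0)
      exact hj (by simp [hjA, h0])
    · simp_rw [fun j => (level_add_tail hd hsupp j).1 s]
      rw [filter_mem_eq_inter, inter_eq_right.2 (hA s).1, (hA s).2]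
  · intro g hg
    simp only [mem_coe, mem_filter, mem_piAntidiag] at hg
    funext j
    simp only [mem_filter]
    by_cases hj : j ∈ S
    · simp only [hj, true_and]
      rw [sum_ite_eq_succ _ _ (min_le_right _ _)]
      omega
    · have h0 : g j = 0 := by
        by_contra h0
        exact hj (hg.1.2 j h0)
      simp [hj, h0]
  · rintro ⟨A, h⟩ hA
    simp only [mem_coe, mem_piAntidiag, mem_sigma, mem_disjointFamilies] at hA
    obtain ⟨⟨hA, hd⟩, hsum, hsupp⟩ := hA
    refine Sigma.ext ?_ (heq_of_eq ?_)
    · funext s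
      ext j
      simp only [mem_filter, (level_add_tail hd hsupp j).1 s]
      exact ⟨fun hj => hj.2, fun hj => ⟨(hA s).1 hj, hj⟩⟩
    · funext j
      exact (level_add_tail hd hsupp j).2

theorem card_filter_zmod (n : ℕ) [NeZero n] (p : ZMod n → Prop) [DecidablePred p] (c : ZMod n) :
    #{i : ZMod n | p i} = #((range n).filter fun i : ℕ => p ((i : ZMod n) + c)) := by
  symm
  refine card_nbij' (fun i => (i : ZMod n) + c) (fun i => (i - c).val) ?_ ?_ ?_ ?_
  · intro i hi
    simpa using (mem_filter.1 hi).2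
  · intro i hi
    have := (mem_filter.1 hi).2
    simp [ZMod.val_lt, this]
  · intro i hi
    have := mem_range.1 (mem_filter.1 hi).1
    simp [ZMod.val_natCast_of_lt this]
  · intro i _
    simp

theorem card_filter_add_right {G : Type*} [AddGroup G] [Fintype G] (p : G → Prop)
    [DecidablePred p] (a : G) : #{i : G | p (i + a)} = #{i : G | p i} :=
  card_equiv (Equiv.addRight a) (by simp)

theorem nedN1_rotate (n : ℕ) [NeZero n] (β : ZMod n → Bool) (a : ZMod n) :
    nedN1 n (fun i => β (i + a)) = nedN1 n β :=
  card_filter_add_right (fun i => β i = true) a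

theorem nedN10r1_rotate (n : ℕ) [NeZero n] (r : ℕ) (β : ZMod n → Bool) (a : ZMod n) :
    nedN10r1 n r (fun i => β (i + a)) = nedN10r1 n r β := by
  simpa only [nedN10r1, add_right_comm _ a] using card_filter_add_right (fun i : ZMod n =>
    β i = true ∧ (∀ j : Fin r, β (i + ((j.val + 1 : ℕ) : ZMod n)) = false) ∧
      β (i + ((r + 1 : ℕ) : ZMod n)) = true) a

theorem nedN0r1_rotate (n : ℕ) [NeZero n] (r : ℕ) (β : ZMod n → Bool) (a : ZMod n) :
    nedN0r1 n r (fun i => β (i + a)) = nedN0r1 n r β := by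
  simpa only [nedN0r1, add_right_comm _ a] using card_filter_add_right (fun i : ZMod n =>
    (∀ j : Fin r, β (i + (j.val : ZMod n)) = false) ∧ β (i + ((r : ℕ) : ZMod n)) = true) a

/-- Double counting of the pairs (configuration, occupied site) in a rotation-invariant class. -/
theorem card_mul_eq_of_rotate (n : ℕ) [NeZero n] (k : ℕ) (X : Finset (ZMod n → Bool))
    (hk : ∀ β ∈ X, nedN1 n β = k) (hX : ∀ β ∈ X, ∀ a, (fun i => β (i + a)) ∈ X) :
    #X * k = n * #{β ∈ X | β 0 = true} := by
  have h := sum_card_bipartiteAbove_eq_sum_card_bipartiteBelow (s := X)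
    (t := (univ : Finset (ZMod n))) (fun β i => β i = true)
  rw [sum_congr rfl (fun β hβ => show #((univ : Finset (ZMod n)).bipartiteAbove
    (fun (β : ZMod n → Bool) i => β i = true) β) = k from hk β hβ)] at h
  have hb : ∀ i ∈ (univ : Finset (ZMod n)),
      #(X.bipartiteBelow (fun β i => β i = true) i) = #{β ∈ X | β 0 = true} := by
    intro i _
    refine card_nbij' (fun β j => β (j + i)) (fun β j => β (j + -i)) ?_ ?_ ?_ ?_
    · intro β hβ
      simp only [bipartiteBelow, mem_coe, mem_filter] at hβ ⊢
      exact ⟨hX β hβ.1 i, by simpa using hβ.2⟩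
    · intro β hβ
      simp only [bipartiteBelow, mem_coe, mem_filter] at hβ ⊢
      exact ⟨hX β hβ.1 (-i), by simpa using hβ.2⟩
    · intro β _
      simp
    · intro β _
      simp
  rw [sum_congr rfl hb] at h
  simpa [ZMod.card] using h

/-- The position of the `j`-th occupied site of the periodic extension of `β` to `ℕ`. -/
noncomputable def onePos (n : ℕ) (β : ZMod n → Bool) (j : ℕ) : ℕ :=
  Nat.nth (fun i => β (i : ZMod n) = true) j

/-- The number of empty sites between the `j`-th occupied site and the next, for `j < k`. -/
noncomputable def gapLength (n k : ℕ) (β : ZMod n → Bool) (j : ℕ) : ℕ :=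
  if j < k then onePos n β (j + 1) - onePos n β j - 1 else 0

/-- The configuration whose first `k` occupied sites, starting from `0`, are separated by gaps
of lengths `g 0, g 1, …`. -/
def ofGaps (n k : ℕ) (g : ℕ → ℕ) (i : ZMod n) : Bool :=
  decide (∃ j < k, ∑ l ∈ range j, (g l + 1) = i.val)

section Occupied

variable {n : ℕ} {β : ZMod n → Bool}

theorem infinite_occupied [NeZero n] (h0 : β 0 = true) :
    (Set.ofPred fun i : ℕ => β (i : ZMod n) = true).Infinite := by
  refine Set.infinite_of_injective_forall_mem (f := fun j => n * j)
    (mul_right_injective₀ (NeZero.ne n)) fun j => ?_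
  change β ((n * j : ℕ) : ZMod n) = true
  simpa using h0

theorem onePos_strictMono [NeZero n] (h0 : β 0 = true) : StrictMono (onePos n β) :=
  Nat.nth_strictMono (infinite_occupied h0)

theorem onePos_zero (h0 : β 0 = true) : onePos n β 0 = 0 :=
  Nat.nth_zero_of_zero (by simpa using h0)

theorem apply_onePos [NeZero n] (h0 : β 0 = true) (j : ℕ) : β (onePos n β j : ZMod n) = true :=
  Nat.nth_mem_of_infinite (infinite_occupied h0) j

theorem nedN1_eq_count [NeZero n] : nedN1 n β = Nat.count (fun i : ℕ => β (i : ZMod n) = true) n := by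
  rw [Nat.count_eq_card_filter_range, nedN1, card_filter_zmod n _ 0]
  simp

theorem onePos_nedN1 [NeZero n] (h0 : β 0 = true) : onePos n β (nedN1 n β) = n := by
  rw [nedN1_eq_count]
  exact Nat.nth_count (p := fun i : ℕ => β (i : ZMod n) = true) (by simpa using h0)

theorem exists_onePos {i : ℕ} (hi : β (i : ZMod n) = true) : ∃ j, onePos n β j = i :=
  ⟨_, Nat.nth_count (p := fun i : ℕ => β (i : ZMod n) = true) hi⟩

theorem apply_eq_false_of_between [NeZero n] (h0 : β 0 = true) {j i : ℕ} (h1 : onePos n β j < i)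
    (h2 : i < onePos n β (j + 1)) : β (i : ZMod n) = false := by
  by_contra hi
  obtain ⟨l, rfl⟩ := exists_onePos (Bool.eq_true_of_not_eq_false hi)
  rw [(onePos_strictMono h0).lt_iff_lt] at h1 h2
  omega

theorem onePos_succ_eq [NeZero n] (h0 : β 0 = true) {k j : ℕ} (hj : j < k) :
    onePos n β (j + 1) = onePos n β j + gapLength n k β j + 1 := by
  have := onePos_strictMono h0 (Nat.lt_succ_self j)
  rw [gapLength, if_pos hj]
  simp only [Nat.succ_eq_add_one] at this
  omega

theorem sum_gapLength [NeZero n] (h0 : β 0 = true) {k j : ℕ} (hj : j ≤ k) :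
    ∑ l ∈ range j, (gapLength n k β l + 1) = onePos n β j := by
  induction j with
  | zero => simp [onePos_zero h0]
  | succ j ih =>
    rw [sum_range_succ, ih (by omega), onePos_succ_eq h0 (show j < k by omega)]
    omega

theorem nedN10r1_eq_card_gapLength [NeZero n] (h0 : β 0 = true) {k : ℕ} (hk : nedN1 n β = k) (r : ℕ) :
    nedN10r1 n r β = #{j ∈ range k | gapLength n k β j = r} := by
  have hn : onePos n β k = n := hk ▸ onePos_nedN1 h0
  have hmono := onePos_strictMono h0
  rw [nedN10r1, card_filter_zmod n _ 0]
  symm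
  refine card_bij (fun j _ => onePos n β j) ?_ (fun _ _ _ _ h => hmono.injective h) ?_
  · intro j hj
    simp only [mem_filter, mem_range, add_zero] at hj ⊢
    have hs := onePos_succ_eq h0 hj.1
    refine ⟨(hmono hj.1).trans_eq hn, apply_onePos h0 j, fun l => ?_, ?_⟩
    · have hl := l.2
      rw [← Nat.cast_add]
      exact apply_eq_false_of_between h0 (j := j) (by omega) (by omega)
    · have := apply_onePos h0 (j + 1)
      rw [hs, hj.2, add_assoc] at this
      exact_mod_cast this
  · intro i hi
    simp only [mem_filter, mem_range, add_zero] at hi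
    obtain ⟨hin, hi1, hz, hlast⟩ := hi
    obtain ⟨j, rfl⟩ := exists_onePos hi1
    have hj : j < k := hmono.lt_iff_lt.1 (hin.trans_eq hn.symm)
    have hs := onePos_succ_eq h0 hj
    refine ⟨j, ?_, rfl⟩
    simp only [mem_filter, mem_range]
    refine ⟨hj, ?_⟩
    by_contra hne
    rcases Nat.lt_or_gt_of_ne hne with h | h
    · have h1 := apply_onePos h0 (j + 1)
      have h2 := hz ⟨_, h⟩
      rw [hs, add_assoc, Nat.cast_add] at h1
      simp only [h1] at h2
      exact Bool.noConfusion h2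
    · have := apply_eq_false_of_between h0 (j := j) (i := onePos n β j + (r + 1))
        (by omega) (by omega)
      rw [Nat.cast_add, hlast] at this
      exact Bool.noConfusion this

theorem nedN0r1_eq_card_gapLength [NeZero n] (h0 : β 0 = true) {k : ℕ} (hk : nedN1 n β = k) (r : ℕ) :
    nedN0r1 n r β = #{j ∈ range k | r ≤ gapLength n k β j} := by
  have hn : onePos n β k = n := hk ▸ onePos_nedN1 h0
  have hmono := onePos_strictMono h0
  have hsub : ∀ i d : ℕ, d ≤ r → d ≤ i + 1 →
      (i : ZMod n) + (1 - (r : ZMod n)) + ((r - d : ℕ) : ZMod n) = ((i + 1 - d : ℕ) : ZMod n) := by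
    intro i d hd hdi
    rw [Nat.cast_sub hd, Nat.cast_sub hdi]
    push_cast
    ring
  have hend : ∀ i : ℕ, (i : ZMod n) + (1 - (r : ZMod n)) + (r : ZMod n) = ((i + 1 : ℕ) : ZMod n) :=
    fun i => hsub i 0 (Nat.zero_le _) (Nat.zero_le _)
  rw [nedN0r1, card_filter_zmod n _ (1 - (r : ZMod n))]
  symm
  refine card_bij (fun j _ => onePos n β (j + 1) - 1) ?_ ?_ ?_
  · intro j hj
    simp only [mem_filter, mem_range] at hj ⊢
    have hs := onePos_succ_eq h0 hj.1
    have hle : onePos n β (j + 1) ≤ onePos n β k := hmono.monotone hj.1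
    refine ⟨by omega, fun l => ?_, ?_⟩
    · have hl := l.2
      have := hsub (onePos n β (j + 1) - 1) (r - l) (by omega) (by omega)
      rw [Nat.sub_sub_self hl.le] at this
      rw [this]
      exact apply_eq_false_of_between h0 (j := j) (by omega) (by omega)
    · rw [hend, Nat.sub_add_cancel (by omega)]
      exact apply_onePos h0 (j + 1)
  · intro j hj j' hj' h
    simp only [mem_filter, mem_range] at hj hj'
    have hs := onePos_succ_eq h0 hj.1
    have hs' := onePos_succ_eq h0 hj'.1
    have := hmono.injective (show onePos n β (j + 1) = onePos n β (j' + 1) by omega)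
    omega
  · intro i hi
    simp only [mem_filter, mem_range] at hi
    obtain ⟨hin, hz, hlast⟩ := hi
    rw [hend] at hlast
    obtain ⟨j, hji⟩ := exists_onePos hlast
    rcases j with _ | j
    · rw [onePos_zero h0] at hji
      omega
    have hj : j + 1 ≤ k := by rw [← hmono.le_iff_le]; omega
    have hs := onePos_succ_eq h0 (show j < k from hj)
    refine ⟨j, ?_, by omega⟩
    simp only [mem_filter, mem_range]
    refine ⟨hj, ?_⟩
    by_contra! hlt
    have h1 := hz ⟨r - (gapLength n k β j + 1), by omega⟩
    simp only at h1
    rw [hsub _ _ (by omega) (by omega), show i + 1 - (gapLength n k β j + 1) = onePos n β j by omega,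
      apply_onePos h0 j] at h1
    exact Bool.noConfusion h1

theorem ofGaps_gapLength [NeZero n] (h0 : β 0 = true) {k : ℕ} (hk : nedN1 n β = k) :
    ofGaps n k (gapLength n k β) = β := by
  have hn : onePos n β k = n := hk ▸ onePos_nedN1 h0
  funext i
  have hiff : (∃ j < k, ∑ l ∈ range j, (gapLength n k β l + 1) = i.val) ↔ β i = true := by
    constructor
    · rintro ⟨j, hj, h⟩
      rw [sum_gapLength h0 hj.le] at h
      have := apply_onePos h0 j
      rwa [h, ZMod.natCast_zmod_val] at this
    · intro hi
      obtain ⟨j, hj⟩ := exists_onePos (β := β) (i := i.val) (by rwa [ZMod.natCast_zmod_val])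
      have hjk : j < k := by
        rw [← (onePos_strictMono h0).lt_iff_lt, hn, hj]
        exact ZMod.val_lt i
      exact ⟨j, hjk, by rw [sum_gapLength h0 hjk.le, hj]⟩
  rw [ofGaps, Bool.eq_iff_iff, decide_eq_true_iff, hiff]

theorem gapLength_mem_piAntidiag [NeZero n] (h0 : β 0 = true) {k : ℕ} (hk : nedN1 n β = k) :
    gapLength n k β ∈ piAntidiag (range k) (n - k) := by
  rw [mem_piAntidiag]
  refine ⟨?_, fun j hj => ?_⟩
  · have h := sum_gapLength h0 (le_refl k)
    rw [show onePos n β k = n from hk ▸ onePos_nedN1 h0, sum_add_distrib] at h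
    simp only [sum_const, card_range, smul_eq_mul, mul_one] at h
    change ∑ l ∈ range k, gapLength n k β l = n - k
    omega
  · by_contra hjk
    exact hj (if_neg fun h => hjk (mem_range.2 h))

end Occupied

section OfGaps

variable {n k : ℕ} {g : ℕ → ℕ}

theorem strictMono_sum_range_succ (g : ℕ → ℕ) :
    StrictMono fun j => ∑ l ∈ range j, (g l + 1) :=
  strictMono_nat_of_lt_succ fun j => by simp [sum_range_succ]

theorem sum_range_succ_of_mem_piAntidiag (hkn : k ≤ n) (hg : g ∈ piAntidiag (range k) (n - k)) :
    ∑ l ∈ range k, (g l + 1) = n := by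
  rw [mem_piAntidiag] at hg
  rw [sum_add_distrib, show ∑ l ∈ range k, g l = n - k from hg.1]
  simp [hkn]

theorem ofGaps_natCast [NeZero n] (hkn : k ≤ n) (hg : g ∈ piAntidiag (range k) (n - k)) {i : ℕ}
    (hi : i < n) :
    ofGaps n k g (i : ZMod n) = true ↔ ∃ j, ∑ l ∈ range j, (g l + 1) = i := by
  rw [ofGaps, decide_eq_true_iff, ZMod.val_natCast_of_lt hi]
  refine ⟨fun ⟨j, _, h⟩ => ⟨j, h⟩, fun ⟨j, h⟩ => ⟨j, ?_, h⟩⟩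
  rw [← (strictMono_sum_range_succ g).lt_iff_lt]
  rwa [h, sum_range_succ_of_mem_piAntidiag hkn hg]

theorem ofGaps_zero (hk : 1 ≤ k) : ofGaps n k g 0 = true := by
  rw [ofGaps, decide_eq_true_iff]
  exact ⟨0, hk, by simp⟩

theorem count_ofGaps [NeZero n] (hkn : k ≤ n) (hg : g ∈ piAntidiag (range k) (n - k)) {j : ℕ} (hj : j ≤ k) :
    Nat.count (fun i : ℕ => ofGaps n k g (i : ZMod n) = true) (∑ l ∈ range j, (g l + 1)) = j := by
  have hmono := strictMono_sum_range_succ g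
  have hle : ∑ l ∈ range j, (g l + 1) ≤ n := by
    have := hmono.monotone hj
    rwa [sum_range_succ_of_mem_piAntidiag hkn hg] at this
  rw [Nat.count_eq_card_filter_range]
  conv_rhs => rw [← card_range j]
  symm
  refine card_bij (fun i _ => ∑ l ∈ range i, (g l + 1)) ?_ (fun _ _ _ _ h => hmono.injective h) ?_
  · intro i hi
    have hlt := hmono (mem_range.1 hi)
    dsimp only at hlt
    exact mem_filter.2
      ⟨mem_range.2 hlt, (ofGaps_natCast hkn hg (by omega)).2 ⟨i, rfl⟩⟩
  · intro i hi
    rw [mem_filter, mem_range] at hi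
    obtain ⟨l, rfl⟩ := (ofGaps_natCast hkn hg (by omega)).1 hi.2
    exact ⟨l, mem_range.2 (hmono.lt_iff_lt.1 hi.1), rfl⟩

theorem nedN1_ofGaps [NeZero n] (hkn : k ≤ n) (hg : g ∈ piAntidiag (range k) (n - k)) :
    nedN1 n (ofGaps n k g) = k := by
  have := count_ofGaps hkn hg le_rfl
  rwa [sum_range_succ_of_mem_piAntidiag hkn hg, ← nedN1_eq_count] at this

theorem onePos_ofGaps [NeZero n] (hk : 1 ≤ k) (hkn : k ≤ n) (hg : g ∈ piAntidiag (range k) (n - k)) {j : ℕ}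
    (hj : j ≤ k) : onePos n (ofGaps n k g) j = ∑ l ∈ range j, (g l + 1) := by
  have hone : ofGaps n k g ((∑ l ∈ range j, (g l + 1) : ℕ) : ZMod n) = true := by
    rcases hj.lt_or_eq with hj | rfl
    · have hlt := strictMono_sum_range_succ g hj
      dsimp only at hlt
      rw [sum_range_succ_of_mem_piAntidiag hkn hg] at hlt
      exact (ofGaps_natCast hkn hg hlt).2 ⟨j, rfl⟩
    · rw [sum_range_succ_of_mem_piAntidiag hkn hg, ZMod.natCast_self]
      exact ofGaps_zero hk
  have := Nat.nth_count (p := fun i : ℕ => ofGaps n k g (i : ZMod n) = true) hone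
  rwa [count_ofGaps hkn hg hj] at this

theorem gapLength_ofGaps [NeZero n] (hk : 1 ≤ k) (hkn : k ≤ n) (hg : g ∈ piAntidiag (range k) (n - k)) :
    gapLength n k (ofGaps n k g) = g := by
  funext j
  rw [gapLength]
  split_ifs with hj
  · rw [onePos_ofGaps hk hkn hg hj, onePos_ofGaps hk hkn hg hj.le, sum_range_succ]
    omega
  · by_contra h
    exact hj (mem_range.1 ((mem_piAntidiag.1 hg).2 j (Ne.symm h)))

end OfGaps

theorem card_configurations_eq_card_gaps (n k t N : ℕ) [NeZero n] (hk : 1 ≤ k) (hkn : k ≤ n)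
    (x : Fin t → ℕ) :
    #{β : ZMod n → Bool | (nedN1 n β = k ∧ (∀ s : Fin t, nedN10r1 n (s.val + 1) β = x s) ∧
        nedN0r1 n (t + 1) β = N) ∧ β 0 = true} =
      #{g ∈ piAntidiag (range k) (n - k) |
        (∀ s : Fin t, #{j ∈ range k | g j = s.val + 1} = x s) ∧
          #{j ∈ range k | t + 1 ≤ g j} = N} := by
  refine card_nbij' (gapLength n k) (ofGaps n k) ?_ ?_ ?_ ?_
  · intro β hβ
    simp only [mem_coe, mem_filter, mem_univ, true_and] at hβ ⊢
    obtain ⟨⟨h1, hx, hN⟩, h0⟩ := hβ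
    refine ⟨gapLength_mem_piAntidiag h0 h1, fun s => ?_, ?_⟩
    · rw [← nedN10r1_eq_card_gapLength h0 h1, hx]
    · rw [← nedN0r1_eq_card_gapLength h0 h1, hN]
  · intro g hg
    simp only [mem_coe, mem_filter, mem_univ, true_and] at hg ⊢
    obtain ⟨hg, hx, hN⟩ := hg
    have h0 : ofGaps n k g 0 = true := ofGaps_zero hk
    have h1 := nedN1_ofGaps hkn hg
    refine ⟨⟨h1, fun s => ?_, ?_⟩, h0⟩
    · rw [nedN10r1_eq_card_gapLength h0 h1, gapLength_ofGaps hk hkn hg, hx]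
    · rw [nedN0r1_eq_card_gapLength h0 h1, gapLength_ofGaps hk hkn hg, hN]
  · intro β hβ
    simp only [mem_coe, mem_filter, mem_univ, true_and] at hβ
    exact ofGaps_gapLength hβ.2 hβ.1.1
  · intro g hg
    exact gapLength_ofGaps hk hkn (mem_filter.1 hg).1

theorem ichoose_sub_one_sub_one (N R : ℕ) (h : N = 0 → R = 0) :
    ichoose ((N : ℤ) + R - 1) ((N : ℤ) - 1) = (N + R - 1).choose R := by
  rcases N with _ | N
  · simp [ichoose, h rfl]
  · rw [ichoose, if_neg (by omega), if_pos (by omega),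
      show (((N + 1 : ℕ) : ℤ) + R - 1).toNat = N + R by omega,
      show (((N + 1 : ℕ) : ℤ) - 1).toNat = N by omega, show N + 1 + R - 1 = N + R by omega,
      Nat.choose_symm_add]

/-- the number of configurations `β` on the ring with `N₁(β) = k`,
`N_{10^s1}(β) = x_s` for each `s ∈ {1,…,m-2}` and `N_{0^{m-1}1}(β) = N` equals
`(n/k) · k!/(x₁!⋯x_{m-2}!·N!·(k-N-∑x)!) · C(n-k-M-(m-2)N-1, N-1)`. -/
theorem ned_configuration_count (n m : ℕ) [NeZero n] (hm : 2 ≤ m) (hmn : m ≤ n)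
    (k : ℕ) (hk1 : 1 ≤ k) (hkn : k ≤ n) (M N : ℕ) (hMN : (M, N) ∈ nedC n m k)
    (x : Fin (m - 2) → ℕ) (hx : x ∈ nedT m k M) :
    (((univ.filter fun β : ZMod n → Bool =>
          nedN1 n β = k ∧ (∀ s : Fin (m - 2), nedN10r1 n (s.val + 1) β = x s) ∧
            nedN0r1 n (m - 1) β = N).card : ℕ) : ℝ) =
      (n : ℝ) / k * (multChain k x N : ℝ) *
        (ichoose ((n : ℤ) - k - M - ((m : ℤ) - 2) * N - 1) ((N : ℤ) - 1) : ℝ) := by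
  obtain ⟨t, rfl⟩ : ∃ t, m = t + 2 := ⟨m - 2, by omega⟩
  have hxM : ∑ s : Fin t, (s.val + 1) * x s = M := (mem_filter.1 hx).2
  obtain ⟨-, hle, hN0⟩ := (mem_filter.1 hMN).2
  simp only [show t + 2 - 1 = t + 1 by omega] at hle hN0
  obtain ⟨R, hR⟩ : ∃ R, n - k = M + (t + 1) * N + R :=
    ⟨n - k - (M + (t + 1) * N), by rw [mul_comm] at hle; omega⟩
  have hR0 : N = 0 → R = 0 := by
    intro h
    have := hN0.1 h
    subst h
    omega
  have hcount := card_mul_eq_of_rotate n k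
    ({β : ZMod n → Bool | nedN1 n β = k ∧ (∀ s : Fin t, nedN10r1 n (s.val + 1) β = x s) ∧
      nedN0r1 n (t + 1) β = N} : Finset (ZMod n → Bool))
    (fun β hβ => (mem_filter.1 hβ).2.1) (fun β hβ a => by
      simpa [nedN1_rotate, nedN10r1_rotate, nedN0r1_rotate] using hβ)
  have hgaps := card_piAntidiag_levels (t := t) (range k) x N R
  rw [hxM, ← hR, card_range] at hgaps
  rw [filter_filter, card_configurations_eq_card_gaps n k t N hk1 hkn x, hgaps,
    ← ichoose_sub_one_sub_one N R hR0] at hcount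
  have harg : (n : ℤ) - k - M - (((t + 2 : ℕ) : ℤ) - 2) * N - 1 = (N : ℤ) + R - 1 := by
    have : (n : ℤ) = k + (M + (t + 1) * N + R) := by
      have : n = k + (M + (t + 1) * N + R) := by omega
      exact_mod_cast this
    rw [this]
    push_cast
    ring
  rw [harg]
  have hk0 : (k : ℝ) ≠ 0 := by exact_mod_cast (by omega : k ≠ 0)
  have hcast := congrArg (Nat.cast : ℕ → ℝ) hcount
  push_cast at hcast
  rw [mul_assoc, div_mul_eq_mul_div, eq_div_iff hk0]
  exact hcast
end

section
/- For the 2-NED, let α, β ∈ Ω be configurations such that there is no site i with α_i = β_i = 1, and let W(γ) = p1^{N1(γ)} · ((1−p1)/p2)^{N_{01}(γ)} be the stationary weight. With Pos_{a_1b_1,a_2b_2} = {i : (α_i, α_{i+1}) = (a_1,b_1), (β_i, β_{i+1}) = (a_2,b_2)}, set u = |Pos_{10,01}| and v = |Pos_{01,10}|. Then W(α)·P(α → β)·((1−p1)(1−p2))^{u}·(p1·p2)^{v} = W(β)·P(β → α)·(p1·p2)^{u}·((1−p1)(1−p2))^{v}; equivalently, the detailed-balance ratio (π(α)P(α → β))/(π(β)P(β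 → α)) equals (p1·p2/((1−p1)(1−p2)))^{u−v}. -/
open Finset

theorem nedQ_two (n : ℕ) (p1 p2 : ℝ) (α : ZMod n → Bool) (i : ZMod n) (b : Bool) :
    nedQ n 2 p1 p2 α i b =
      if α i = true then (if b then 0 else 1)
      else if α (i + 1) = true then (if b then 1 - p2 else p2)
      else (if b then p1 else 1 - p1) := by
  cases h0 : α i <;> cases h1 : α (i + 1) <;> simp [nedQ, Fin.forall_fin_succ, h0, h1]

theorem pow_card_filter_univ {ι M : Type*} [Fintype ι] [CommMonoid M] (p : ι → Prop)
    [DecidablePred p] (a : M) :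
    a ^ (univ.filter p).card = ∏ i, if p i then a else 1 := by
  rw [← Finset.prod_filter, Finset.prod_const]

theorem nedW_two_eq_prod (n : ℕ) [NeZero n] (p1 p2 : ℝ) (α : ZMod n → Bool) :
    nedW n 2 p1 p2 α =
      ∏ i : ZMod n, (if α i = true then p1 else 1) *
        (if α i = false ∧ α (i + 1) = true then (1 - p1) / p2 else 1) := by
  rw [Finset.prod_mul_distrib, ← pow_card_filter_univ, ← pow_card_filter_univ, div_pow]
  simp [nedW, nedN1, nedN0r1, mul_div_assoc]

theorem nedW_two_pos (n : ℕ) [NeZero n] {p1 p2 : ℝ} (hp1 : p1 ∈ Set.Ioo (0 : ℝ) 1)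
    (hp2 : 0 < p2) (α : ZMod n → Bool) : 0 < nedW n 2 p1 p2 α := by
  have h1 : 0 < 1 - p1 := sub_pos.2 hp1.2
  have h0 : 0 < p1 := hp1.1
  unfold nedW
  positivity

theorem nedP_two_pos (n : ℕ) [NeZero n] {p1 p2 : ℝ} (hp1 : p1 ∈ Set.Ioo (0 : ℝ) 1)
    (hp2 : p2 ∈ Set.Ioo (0 : ℝ) 1) {α β : ZMod n → Bool}
    (h : ∀ i, ¬ (α i = true ∧ β i = true)) : 0 < nedP n 2 p1 p2 α β := by
  have h1 : 0 < 1 - p1 := sub_pos.2 hp1.2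
  have h2 : 0 < 1 - p2 := sub_pos.2 hp2.2
  refine Finset.prod_pos fun i _ => ?_
  have hi := h i
  rw [nedQ_two]
  cases ha : α i <;> cases hb : β i <;> cases hc : α (i + 1) <;>
    simp_all [hp1.1, hp2.1]

theorem nedW_two_mul_nedP_two (n : ℕ) [NeZero n] {p1 p2 : ℝ} (hp2 : p2 ≠ 0)
    {α β : ZMod n → Bool} (h : ∀ i, ¬ (α i = true ∧ β i = true)) :
    nedW n 2 p1 p2 α * nedP n 2 p1 p2 α β *
          ((1 - p1) * (1 - p2)) ^ posCount n α β true false false true *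
          (p1 * p2) ^ posCount n α β false true true false =
        nedW n 2 p1 p2 β * nedP n 2 p1 p2 β α *
          (p1 * p2) ^ posCount n α β true false false true *
          ((1 - p1) * (1 - p2)) ^ posCount n α β false true true false := by
  simp only [nedW_two_eq_prod, nedP, posCount, pow_card_filter_univ, nedQ_two,
    ← Finset.prod_mul_distrib]
  refine Finset.prod_congr rfl fun i _ => ?_
  have hi := h i
  have hi' := h (i + 1)
  cases ha : α i <;> cases hb : β i <;> cases hc : α (i + 1) <;> cases hd : β (i + 1) <;>
    simp_all <;> field_simp

/-- for the 2-NED, if `α` and `β` share no common `1`, then with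
`u = |Pos_{10,01}|` and `v = |Pos_{01,10}|` one has
`W(α) P(α→β) ((1-p1)(1-p2))^u (p1 p2)^v = W(β) P(β→α) (p1 p2)^u ((1-p1)(1-p2))^v`;
equivalently the detailed-balance ratio equals `(p1 p2 / ((1-p1)(1-p2)))^{u-v}`. -/
theorem ned2_detailed_balance_ratio (n : ℕ) [NeZero n] (hn : 2 ≤ n)
    (p1 p2 : ℝ) (hp1 : p1 ∈ Set.Ioo (0 : ℝ) 1) (hp2 : p2 ∈ Set.Ioo (0 : ℝ) 1)
    (α β : ZMod n → Bool) (h : ¬ ∃ i : ZMod n, α i = true ∧ β i = true) :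
    nedW n 2 p1 p2 α * nedP n 2 p1 p2 α β *
          ((1 - p1) * (1 - p2)) ^ posCount n α β true false false true *
          (p1 * p2) ^ posCount n α β false true true false =
        nedW n 2 p1 p2 β * nedP n 2 p1 p2 β α *
          (p1 * p2) ^ posCount n α β true false false true *
          ((1 - p1) * (1 - p2)) ^ posCount n α β false true true false ∧
      (nedW n 2 p1 p2 α / nedZ n 2 p1 p2 * nedP n 2 p1 p2 α β) /
          (nedW n 2 p1 p2 β / nedZ n 2 p1 p2 * nedP n 2 p1 p2 β α) =
        (p1 * p2 / ((1 - p1) * (1 - p2))) ^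
          ((posCount n α β true false false true : ℤ) -
            (posCount n α β false true true false : ℤ)) := by
  have hαβ : ∀ i, ¬ (α i = true ∧ β i = true) := not_exists.1 h
  have hβα : ∀ i, ¬ (β i = true ∧ α i = true) := fun i hi => hαβ i hi.symm
  have hbal := nedW_two_mul_nedP_two n (p1 := p1) hp2.1.ne' hαβ
  refine ⟨hbal, ?_⟩
  have hZ : nedZ n 2 p1 p2 ≠ 0 :=
    (Finset.sum_pos (fun γ _ => nedW_two_pos n hp1 hp2.1 γ) univ_nonempty).ne'
  have hW := (nedW_two_pos n hp1 hp2.1 β).ne'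
  have hP := (nedP_two_pos n hp1 hp2 hβα).ne'
  have hx : p1 * p2 ≠ 0 := mul_ne_zero hp1.1.ne' hp2.1.ne'
  have hy : (1 - p1) * (1 - p2) ≠ 0 :=
    mul_ne_zero (sub_pos.2 hp1.2).ne' (sub_pos.2 hp2.2).ne'
  rw [div_mul_eq_mul_div, div_mul_eq_mul_div, div_div_div_cancel_right₀ hZ,
    zpow_sub₀ (div_ne_zero hx hy), zpow_natCast, zpow_natCast, div_pow, div_pow, div_div_div_eq,
    div_eq_div_iff (mul_ne_zero hW hP) (mul_ne_zero (pow_ne_zero _ hy) (pow_ne_zero _ hx))]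
  linear_combination hbal
end
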